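/- arXiv:2303.15146 — 2 statements merged into one kernel-verified Lean document; each statement's English description precedes it below -/
import Mathlib

section
/- Let A be a complex Banach algebra with identity and let a, b, c, d ∈ A. Suppose a and d are Hirano invertible, bc is strongly Drazin invertible with strongly Drazin inverse (bc)^D, and (bc)^D a = 0, bca(bc)^π = 0 (where (bc)^π = 1 − bc(bc)^D), bdc = 0, and bd² = 0. Then the 2×2 matrix with rows (a, b) and (c, d) is Hirano invertible in M₂(A). -/
/-- An element of a ring is *Hirano invertible* if there exists `x` with
`a * x = x * a`, `x = x * a * x`, and `a ^ 2 - a * x` nilpotent. -/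
def IsHirano {R : Type*} [Ring R] (a : R) : Prop :=
  ∃ x : R, a * x = x * a ∧ x = x * a * x ∧ IsNilpotent (a ^ 2 - a * x)

/-- `y` is the *strongly Drazin inverse* of `b`: `b * y = y * b`, `y = y * b * y`,
and `b - b * y` is nilpotent. -/
def IsSDrazinInv {R : Type*} [Ring R] (b y : R) : Prop :=
  b * y = y * b ∧ y = y * b * y ∧ IsNilpotent (b - b * y)

section Characterization

variable {R : Type*} [Ring R]

theorem IsSDrazinInv.isNilpotent_sub_sq {b y : R} (h : IsSDrazinInv b y) :
    IsNilpotent (b - b ^ 2) := by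
  obtain ⟨hc, hy, hn⟩ := h
  have hbe : Commute b (b * y) := (Commute.refl b).mul_right hc
  have he : b * y * (b * y) = b * y := by
    rw [mul_assoc, ← mul_assoc y b y, ← hy]
  have hfac : b - b ^ 2 = (b - b * y) * (1 - b - b * y) := by
    have : (b - b * y) * (1 - b - b * y)
        = b - b ^ 2 - (b * (b * y) - b * y * b) - (b * y - b * y * (b * y)) := by noncomm_ring
    rw [this, hbe.eq, he]
    simp
  rw [hfac]
  refine Commute.isNilpotent_mul_right ?_ hn
  have h1 : Commute (b - b * y) b := (Commute.refl b).sub_left hbe.symm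
  have h2 : Commute (b - b * y) (b * y) := hbe.sub_left (Commute.refl _)
  exact ((Commute.one_right _).sub_right h1).sub_right h2

theorem isNilpotent_sub_cube_of_sq {a : R} (h : IsNilpotent (a ^ 2 - (a ^ 2) ^ 2)) :
    IsNilpotent (a - a ^ 3) := by
  have hfac : (a - a ^ 3) ^ 2 = (a ^ 2 - (a ^ 2) ^ 2) * (1 - a ^ 2) := by noncomm_ring
  have hc : Commute (a ^ 2 - (a ^ 2) ^ 2) (1 - a ^ 2) := by
    rw [Commute, SemiconjBy]
    noncomm_ring
  exact IsNilpotent.of_pow (hfac ▸ hc.isNilpotent_mul_right h)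

theorem IsHirano.isNilpotent_sub_cube {a : R} (h : IsHirano a) : IsNilpotent (a - a ^ 3) := by
  obtain ⟨x, hc, hx, hn⟩ := h
  have hax : Commute a x := hc
  have hsq : a ^ 2 * x ^ 2 = a * x := by
    rw [← hax.mul_pow, sq, mul_assoc, ← mul_assoc x a x, ← hx]
  refine isNilpotent_sub_cube_of_sq (IsSDrazinInv.isNilpotent_sub_sq (y := x ^ 2) ⟨?_, ?_, ?_⟩)
  · exact (hax.pow_pow 2 2).eq
  · rw [mul_assoc, hsq, sq, mul_assoc, ← mul_assoc x a x, ← hx]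
  · rwa [hsq]

open Polynomial in
theorem isHirano_of_isNilpotent_sub_cube {a : R} (h : IsNilpotent (a - a ^ 3)) :
    IsHirano a := by
  obtain ⟨k, hk⟩ := h
  have hzero {p : ℤ[X]} (hp : (X - X ^ 3) ^ k ∣ p) : aeval a p = 0 := by
    obtain ⟨q, rfl⟩ := hp
    simp [hk]
  obtain ⟨u, v, huv⟩ : IsCoprime ((X : ℤ[X]) ^ (k + 1)) ((1 - X ^ 2) ^ (k + 1)) :=
    IsCoprime.pow ⟨X, 1, by ring⟩
  have hf : (X - X ^ 3 : ℤ[X]) ^ k = X ^ k * (1 - X ^ 2) ^ k := by rw [← mul_pow]; ring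
  set y : ℤ[X] := u * X ^ (k + 1) * (u * X ^ k) with hy
  refine ⟨aeval a y, ?_, ?_, k, ?_⟩
  · simpa using congrArg (aeval a) (mul_comm X y)
  · have h0 : aeval a (y - y * X * y) = 0 := hzero ⟨
      u * X ^ k * u * X * (1 + u * X ^ (k + 1)) * v * (1 - X ^ 2), by
        rw [hf, hy]
        linear_combination
          (-u * X ^ (k + 1) * (u * X ^ k) * (1 + u * X ^ (k + 1))) * huv⟩
    simpa [sub_eq_zero] using h0
  · have h0 : aeval a ((X ^ 2 - X * y) ^ k) = 0 := hzero (pow_dvd_pow_of_dvd ⟨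
      v * (1 - X ^ 2) ^ k * X * (1 + u * X ^ (k + 1)) - u ^ 2 * X ^ (2 * k + 1), by
        rw [hy]
        linear_combination
          (-X ^ 2 * (1 + u * X ^ (k + 1))) * huv⟩ k)
    simpa using h0

end Characterization

section Torsion

variable {R : Type*} [Ring R]

/-- The left ideal of elements annihilated on the right by some power of `s`. -/
def powTorsion (s : R) : Submodule R R where
  carrier := {w | ∃ k : ℕ, w * s ^ k = 0}
  zero_mem' := ⟨0, by simp⟩
  add_mem' := by
    rintro v w ⟨k, hk⟩ ⟨l, hl⟩
    refine ⟨k + l, ?_⟩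
    rw [add_mul, pow_add, ← mul_assoc, hk, zero_mul, (Commute.pow_pow_self s k l).eq,
      ← mul_assoc, hl, zero_mul, add_zero]
  smul_mem' := by
    rintro r w ⟨k, hk⟩
    exact ⟨k, by rw [smul_eq_mul, mul_assoc, hk, mul_zero]⟩

theorem mul_mem_powTorsion {s w : R} (r : R) (hw : w ∈ powTorsion s) :
    r * w ∈ powTorsion s :=
  (powTorsion s).smul_mem r hw

theorem mul_mem_powTorsion_of_commute {s w t : R} (ht : Commute t s)
    (hw : w ∈ powTorsion s) : w * t ∈ powTorsion s := by
  obtain ⟨k, hk⟩ := hw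
  exact ⟨k, by rw [mul_assoc, (ht.pow_right k).eq, ← mul_assoc, hk, zero_mul]⟩

theorem mem_powTorsion_of_mul_pow_mem {s w : R} (n : ℕ) (hw : w * s ^ n ∈ powTorsion s) :
    w ∈ powTorsion s := by
  obtain ⟨k, hk⟩ := hw
  exact ⟨n + k, by rw [pow_add, ← mul_assoc, hk]⟩

/-- If `t` divides a power of `s`, then right multiplication by powers of `t` is injective
modulo `powTorsion s`. -/
theorem mem_powTorsion_of_mul_pow_mem_of_dvd {s t r w : R} {m : ℕ} (htr : t * r = s ^ m)
    (hc : Commute t r) (hrs : Commute r s) (n : ℕ) (hw : w * t ^ n ∈ powTorsion s) :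
    w ∈ powTorsion s := by
  refine mem_powTorsion_of_mul_pow_mem (m * n) ?_
  have := mul_mem_powTorsion_of_commute (hrs.pow_left n) hw
  rwa [mul_assoc, ← hc.mul_pow, htr, ← pow_mul] at this

theorem mul_sub_mul_mem_powTorsion_mul {s w y y' x x' : R} (hy' : Commute y' s)
    (h : w * y - x * w ∈ powTorsion s) (h' : w * y' - x' * w ∈ powTorsion s) :
    w * (y * y') - x * x' * w ∈ powTorsion s := by
  have : w * (y * y') - x * x' * w = (w * y - x * w) * y' + x * (w * y' - x' * w) := by
    noncomm_ring
  rw [this]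
  exact add_mem (mul_mem_powTorsion_of_commute hy' h) (mul_mem_powTorsion x h')

theorem mul_sub_mul_mem_powTorsion_pow {s w y x : R} (hy : Commute y s)
    (h : w * y - x * w ∈ powTorsion s) (n : ℕ) :
    w * y ^ n - x ^ n * w ∈ powTorsion s := by
  induction n with
  | zero => simp
  | succ n ih =>
    rw [pow_succ, pow_succ]
    exact mul_sub_mul_mem_powTorsion_mul hy ih h

theorem mul_sub_mul_mem_powTorsion_sub {s w y y' x x' : R}
    (h : w * y - x * w ∈ powTorsion s) (h' : w * y' - x' * w ∈ powTorsion s) :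
    w * (y - y') - (x - x') * w ∈ powTorsion s := by
  have : w * (y - y') - (x - x') * w = (w * y - x * w) - (w * y' - x' * w) := by noncomm_ring
  rw [this]
  exact sub_mem h h'

/-- If `w * y ≡ x * w` modulo `powTorsion s` and `x - x ^ n` is nilpotent, while `y - y ^ n`
divides a power of `s`, then `w` is torsion. -/
theorem mem_powTorsion_of_isNilpotent_sub_pow {s w y x r : R} {m n : ℕ} (hy : Commute y s)
    (hyr : Commute y r) (hrs : Commute r s) (hs : (y - y ^ n) * r = s ^ m)
    (hx : IsNilpotent (x - x ^ n)) (h : w * y - x * w ∈ powTorsion s) : w ∈ powTorsion s := by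
  obtain ⟨k, hk⟩ := hx
  have key := mul_sub_mul_mem_powTorsion_pow (hy.sub_left (hy.pow_left n))
    (mul_sub_mul_mem_powTorsion_sub h (mul_sub_mul_mem_powTorsion_pow hy h n)) k
  rw [hk, zero_mul, sub_zero] at key
  exact mem_powTorsion_of_mul_pow_mem_of_dvd hs (hyr.sub_left (hyr.pow_left n)) hrs k key

/-- The elimination behind `hirano_two_by_two`: `u` and `v` play the role of the two rows of the
identity matrix, on which `M` acts through the coefficients `a, b, c, d`. -/
theorem mem_powTorsion_of_rows {M a b c d e u v : R} (ha : IsNilpotent (a - a ^ 3))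
    (hd : IsNilpotent (d - d ^ 3)) (hbc : IsNilpotent (b * c - (b * c) ^ 2))
    (he : b * c * e = e * (b * c)) (hea : e * a = 0) (hae : b * c * a * (1 - e) = 0)
    (hbdc : b * d * c = 0) (hbd : b * d ^ 2 = 0)
    (hu : u * M = a * u + b * v) (hv : v * M = c * u + d * v) :
    u ∈ powTorsion (M - M ^ 3) ∧ v ∈ powTorsion (M - M ^ 3) := by
  set s := M - M ^ 3 with hs
  have hM : Commute M s := (Commute.refl M).sub_right (Commute.self_pow M 3)
  have hM2 : Commute (M ^ 2) s := hM.pow_left 2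
  have of_cube {x w : R} (hx : IsNilpotent (x - x ^ 3)) (h : w * M - x * w ∈ powTorsion s) :
      w ∈ powTorsion s :=
    mem_powTorsion_of_isNilpotent_sub_pow (m := 1) (r := 1) hM (Commute.one_right _)
      (Commute.one_left _) (by simp [hs]) hx h
  have of_sq {x w : R} (hx : IsNilpotent (x - x ^ 2))
      (h : w * M ^ 2 - x * w ∈ powTorsion s) : w ∈ powTorsion s :=
    mem_powTorsion_of_isNilpotent_sub_pow (m := 2) (r := 1 - M ^ 2) hM2
      ((Commute.one_right _).sub_right (Commute.refl _)) ((Commute.one_left _).sub_left hM2)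
      (by rw [hs]; noncomm_ring) hx h
  have hbv : b * v * M - b * c * u ∈ powTorsion s := by
    refine mem_powTorsion_of_mul_pow_mem_of_dvd (t := M) (r := 1 - M ^ 2) (m := 1)
      (by rw [hs]; noncomm_ring) ((Commute.one_right _).sub_right (Commute.self_pow M 2))
      ((Commute.one_left _).sub_left hM2) 1 ?_
    have : (b * v * M - b * c * u) * M ^ 1 = 0 := by
      calc (b * v * M - b * c * u) * M ^ 1
          = b * (v * M) * M - b * c * (u * M) := by noncomm_ring
        _ = b * (c * u + d * v) * M - b * c * (u * M) := by rw [hv]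
        _ = b * d * (v * M) := by noncomm_ring
        _ = b * d * c * u + b * d ^ 2 * v := by rw [hv]; noncomm_ring
        _ = 0 := by rw [hbdc, hbd]; simp
    rw [this]
    exact zero_mem _
  have hquad : u * M ^ 2 - a * u * M - b * c * u ∈ powTorsion s := by
    convert hbv using 1
    rw [sq, ← mul_assoc, hu]
    noncomm_ring
  have heu : e * u ∈ powTorsion s := by
    refine of_sq hbc ?_
    convert mul_mem_powTorsion e hquad using 1
    rw [← mul_assoc, he]
    calc e * u * M ^ 2 - e * (b * c) * u
        = e * u * M ^ 2 - e * a * u * M - e * (b * c) * u := by rw [hea]; simp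
      _ = _ := by noncomm_ring
  have hw : u * M - a * u ∈ powTorsion s := by
    refine of_sq hbc ?_
    convert add_mem (mul_mem_powTorsion_of_commute hM hquad)
      (mul_mem_powTorsion (b * c * a) heu) using 1
    have : b * c * a * (e * u) = b * c * a * u := by
      rw [← mul_assoc]
      rw [mul_sub, mul_one, sub_eq_zero] at hae
      rw [← hae]
    rw [this]
    noncomm_ring
  have hu' : u ∈ powTorsion s := of_cube ha hw
  refine ⟨hu', of_cube hd ?_⟩
  rw [hv, add_sub_cancel_right]
  exact mul_mem_powTorsion c hu'

end Torsion

/-- If `a, d` are Hirano invertible, `b * c` is strongly Drazin invertible with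
strong Drazin inverse `bcD`, `bcD * a = 0`, `b * c * a * (bc)π = 0`, `b * d * c = 0`
and `b * d ^ 2 = 0`, then `!![a, b; c, d]` is Hirano invertible in `M₂(A)`. -/
theorem hirano_two_by_two {A : Type*} [NormedRing A] [NormedAlgebra ℂ A]
    [CompleteSpace A] (a b c d bcD : A) (ha : IsHirano a) (hd : IsHirano d)
    (hbc : IsSDrazinInv (b * c) bcD)
    (h1 : bcD * a = 0) (h2 : b * c * a * (1 - b * c * bcD) = 0)
    (h3 : b * d * c = 0) (h4 : b * d ^ 2 = 0) :
    IsHirano (!![a, b; c, d] : Matrix (Fin 2) (Fin 2) A) := by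
  set M : Matrix (Fin 2) (Fin 2) A := !![a, b; c, d] with hM
  let φ : A →+* Matrix (Fin 2) (Fin 2) A := Matrix.scalar (Fin 2)
  have hφ (x : A) : φ x = !![x, 0; 0, x] := by
    ext i j
    fin_cases i <;> fin_cases j <;> simp [φ]
  have nil {x : A} {n : ℕ} (h : IsNilpotent (x - x ^ n)) : IsNilpotent (φ x - φ x ^ n) := by
    simpa using h.map φ
  have hbcn : IsNilpotent (φ b * φ c - (φ b * φ c) ^ 2) := by
    rw [← map_mul]
    exact nil hbc.isNilpotent_sub_sq
  obtain ⟨hu, hv⟩ := mem_powTorsion_of_rows (M := M) (e := φ (b * c * bcD))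
    (u := !![1, 0; 0, 0]) (v := !![0, 1; 0, 0])
    (nil ha.isNilpotent_sub_cube) (nil hd.isNilpotent_sub_cube) hbcn
    (by rw [← map_mul, ← map_mul, ← map_mul, mul_assoc (b * c) bcD, ← hbc.1])
    (by rw [← map_mul, mul_assoc, h1, mul_zero, map_zero])
    (by rw [← map_one φ, ← map_mul, ← map_sub, ← map_mul, ← map_mul, h2, map_zero])
    (by rw [← map_mul, ← map_mul, h3, map_zero])
    (by rw [← map_pow, ← map_mul, h4, map_zero])
    (by ext i j; fin_cases i <;> fin_cases j <;> simp [hφ, hM])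
    (by ext i j; fin_cases i <;> fin_cases j <;> simp [hφ, hM])
  have hone : (1 : Matrix (Fin 2) (Fin 2) A) ∈ powTorsion (M - M ^ 3) := by
    convert add_mem hu (mul_mem_powTorsion !![0, 0; 1, 0] hv) using 1
    simp [Matrix.one_fin_two]
  obtain ⟨k, hk⟩ := hone
  exact isHirano_of_isNilpotent_sub_cube ⟨k, by rwa [one_mul] at hk⟩
end

section
/- Let A be a complex Banach algebra with identity, let a ∈ A be Hirano invertible, and let b ∈ A be strongly Drazin invertible with strongly Drazin inverse b^D. If b^D a = 0 and a b b^π = b a b^π (where b^π = 1 − bb^D), then the 2×2 anti-triangular matrix with rows (a, 1) and (b, 0) is Hirano invertible in M₂(A). -/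
/-- A pairwise commuting set lies in a commutative subring. -/
theorem exists_subring_comm_of_pairwise_comm {R : Type*} [Ring R] (s : Set R)
    (hs : ∀ x ∈ s, ∀ y ∈ s, x * y = y * x) :
    ∃ (C : Subring R) (_ : ∀ x y : C, x * y = y * x), s ⊆ C :=
  ⟨Subring.closure s, (Subring.isMulCommutative_closure hs).is_comm.comm, Subring.subset_closure⟩

theorem isNilpotent_subring_coe {R : Type*} [Ring R] {C : Subring R} {x : C} :
    IsNilpotent (x : R) ↔ IsNilpotent x :=
  IsNilpotent.map_iff (f := C.subtype) Subtype.val_injective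

theorem isNilpotent_mul_add_mul {R : Type*} [CommRing R] {x y : R} (hx : IsNilpotent x)
    (hy : IsNilpotent y) (u v : R) : IsNilpotent (u * x + v * y) :=
  (Commute.all _ _).isNilpotent_add ((Commute.all u x).isNilpotent_mul_left hx)
    ((Commute.all v y).isNilpotent_mul_left hy)

theorem IsHirano.isNilpotent_pow_three_sub_self {R : Type*} [Ring R] {a : R}
    (ha : IsHirano a) : IsNilpotent (a ^ 3 - a) := by
  obtain ⟨x, hc, hx, hn⟩ := ha
  obtain ⟨C, hC, hs⟩ := exists_subring_comm_of_pairwise_comm {a, x} (by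
    rintro _ (rfl | rfl) _ (rfl | rfl) <;> simp [hc])
  let _ : CommRing C := { (inferInstance : Ring C) with mul_comm := hC }
  lift a to C using hs (by simp)
  lift x to C using hs (by simp)
  norm_cast at hx hn ⊢
  rw [isNilpotent_subring_coe] at hn ⊢
  have h : IsNilpotent ((a ^ 3 - a) ^ 2) := by
    have e : (a ^ 3 - a) ^ 2 =
        ((a ^ 2 - 1) ^ 2 + a * x * (a ^ 2 + a * x - 2)) * (a ^ 2 - a * x) := by
      linear_combination (a - a ^ 2 * x) * hx
    rw [e]
    exact (Commute.all _ _).isNilpotent_mul_left hn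
  exact (IsNilpotent.pow_iff_pos two_ne_zero).1 h

theorem isHirano_of_isNilpotent_pow_three_sub_self {R : Type*} [Ring R] {a : R}
    (ha : IsNilpotent (a ^ 3 - a)) : IsHirano a := by
  obtain ⟨C, hC, hs⟩ := exists_subring_comm_of_pairwise_comm {a} (by
    rintro _ rfl _ rfl; rfl)
  let _ : CommRing C := { (inferInstance : Ring C) with mul_comm := hC }
  lift a to C using hs (by simp)
  norm_cast at ha
  rw [isNilpotent_subring_coe] at ha
  obtain ⟨e, he, hea⟩ := exists_isIdempotentElem_eq_of_ker_isNilpotent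
    (Ideal.Quotient.mk (nilradical C)) (fun x hx ↦ by
      rwa [Ideal.mk_ker, mem_nilradical] at hx) (Ideal.Quotient.mk _ (a ^ 2)) ⟨_, rfl⟩ (by
      rw [IsIdempotentElem, ← map_mul, Ideal.Quotient.eq, mem_nilradical]
      convert (Commute.all a _).isNilpotent_mul_left ha using 1
      ring)
  have hn : IsNilpotent (a ^ 2 - e) := by
    rwa [eq_comm, Ideal.Quotient.eq, mem_nilradical] at hea
  obtain ⟨u, hu⟩ := hn.isUnit_one_add
  have he' : e * e = e := he
  have hax : a * (e * a * ↑u⁻¹) = e := by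
    have h : (u : C) * ↑u⁻¹ = 1 := u.mul_inv
    linear_combination e * h - e * ↑u⁻¹ * hu + ↑u⁻¹ * he'
  refine ⟨(e * a * ↑u⁻¹ : C), ?_, ?_, ?_⟩
  · exact congrArg Subtype.val (mul_comm a (e * a * ↑u⁻¹))
  · refine congrArg Subtype.val (?_ : e * a * ↑u⁻¹ = e * a * ↑u⁻¹ * a * (e * a * ↑u⁻¹))
    linear_combination (-(e * a * ↑u⁻¹)) * hax - a * ↑u⁻¹ * he'
  · rw [← isNilpotent_subring_coe] at hn
    norm_cast at hn ⊢
    rwa [hax]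

/-- Roots `s` of `s ^ 2 = a * s + b` inherit the identity `a ^ 3 = a` up to nilpotents if
`b` is nilpotent and everything commutes. -/
theorem isNilpotent_pow_three_sub_self_of_sq_eq {R : Type*} [Ring R] {s a b : R}
    (hsa : s * a = a * s) (hsb : s * b = b * s) (hab : a * b = b * a)
    (h : s ^ 2 = a * s + b) (ha : IsNilpotent (a ^ 3 - a)) (hb : IsNilpotent b) :
    IsNilpotent (s ^ 3 - s) := by
  obtain ⟨C, hC, hs⟩ := exists_subring_comm_of_pairwise_comm {s, a, b} (by
    rintro _ (rfl | rfl | rfl) _ (rfl | rfl | rfl) <;> simp [hsa, hsb, hab])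
  let _ : CommRing C := { (inferInstance : Ring C) with mul_comm := hC }
  lift s to C using hs (by simp)
  lift a to C using hs (by simp)
  lift b to C using hs (by simp)
  norm_cast at h ha
  norm_cast
  rw [isNilpotent_subring_coe] at ha ⊢
  rw [isNilpotent_subring_coe] at hb
  rw [← IsNilpotent.pow_iff_pos two_ne_zero]
  have e1 : s ^ 3 - s = (a ^ 2 - 1) * s + b * (a + s) := by
    linear_combination (s + a) * h
  have e : (s ^ 3 - s) ^ 2 = ((a ^ 2 - 1) * s) * (a ^ 3 - a)
      + ((a ^ 2 - 1) ^ 2 + 2 * (a ^ 2 - 1) * s * (a + s) + b * (a + s) ^ 2) * b := by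
    rw [e1]
    linear_combination (a ^ 2 - 1) ^ 2 * h
  rw [e]
  exact isNilpotent_mul_add_mul ha hb _ _

theorem mul_pow_mul_of_mul_mul {R : Type*} [Ring R] {x f : R} (hf : f * f = f)
    (h : f * x * f = x * f) (n : ℕ) : f * x ^ n * f = x ^ n * f := by
  induction n with
  | zero => simp [hf]
  | succ n ih =>
    calc f * x ^ (n + 1) * f = f * x * (x ^ n * f) := by rw [pow_succ']; noncomm_ring
      _ = f * x * f * (x ^ n * f) := by
        rw [← ih]; simp only [mul_assoc]; simp only [← mul_assoc f f, hf]
      _ = x * (f * x ^ n * f) := by rw [h]; noncomm_ring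
      _ = x ^ (n + 1) * f := by rw [ih, pow_succ', mul_assoc]

theorem mul_pow_mul_right_of_mul_mul {R : Type*} [Ring R] {x f : R} (hf : f * f = f)
    (h : f * x * f = x * f) (n : ℕ) : (x * f) ^ n * f = x ^ n * f := by
  induction n with
  | zero => simp
  | succ n ih =>
    rw [_root_.pow_succ', mul_assoc, ih, mul_assoc, ← mul_assoc f, mul_pow_mul_of_mul_mul hf h,
      ← mul_assoc, ← _root_.pow_succ']

theorem isNilpotent_mul_of_mul_mul {R : Type*} [Ring R] {x f : R} (hf : f * f = f)
    (h : f * x * f = x * f) (hx : IsNilpotent x) : IsNilpotent (x * f) := by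
  obtain ⟨n, hn⟩ := hx
  refine ⟨n + 1, ?_⟩
  have h' : (x * f) ^ (n + 1) * f = (x * f) ^ (n + 1) := by
    rw [pow_succ, mul_assoc, mul_assoc, hf]
  rw [← h', mul_pow_mul_right_of_mul_mul hf h, pow_succ', hn]
  simp

theorem pow_three_sub_self_mul {R : Type*} [Ring R] {x f : R} (hf : f * f = f)
    (h : f * x * f = x * f) : (x * f) ^ 3 - x * f = (x ^ 3 - x) * f := by
  rw [sub_mul, ← mul_pow_mul_right_of_mul_mul hf h, pow_succ, mul_assoc, mul_assoc x, hf]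

theorem mul_pow_three_sub_self_mul {R : Type*} [Ring R] {x f : R} (hf : f * f = f)
    (h : f * x * f = x * f) : f * (x ^ 3 - x) * f = (x ^ 3 - x) * f := by
  rw [mul_sub, sub_mul, sub_mul, mul_pow_mul_of_mul_mul hf h, h]

/-- A block triangular element `x`, with respect to `1 = e + f`, whose iterates vanish on
both blocks is nilpotent. -/
theorem isNilpotent_of_mul_pow_eq_zero {R : Type*} [Ring R] {x e f : R} {p q : ℕ}
    (hef : e + f = 1) (he : e * x ^ p = 0) (hf : x ^ q * f = 0) : IsNilpotent x := by
  refine ⟨q + p, ?_⟩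
  calc x ^ (q + p) = x ^ q * (e + f) * x ^ p := by rw [hef, mul_one, pow_add]
    _ = x ^ q * (e * x ^ p) + x ^ q * f * x ^ p := by noncomm_ring
    _ = 0 := by rw [he, hf]; simp

/-- If `e * x ^ 2 = b * e` with `b` unipotent relative to `e`, then `x ^ 3 - x` is
nilpotent on the `e` block. -/
theorem exists_mul_pow_three_sub_self_pow_eq_zero {R : Type*} [Ring R] {x e b : R}
    (hee : e * e = e) (hx : e * x ^ 2 = b * e) (hn : IsNilpotent (b - e)) :
    ∃ p, e * (x ^ 3 - x) ^ p = 0 := by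
  have key (n : ℕ) : e * (x ^ 3 - x) ^ n = (b - e) ^ n * e * x ^ n := by
    induction n with
    | zero => simp
    | succ n ih =>
      have hx3 : e * (x ^ 3 - x) = (b - e) * e * x := by
        rw [mul_sub, _root_.pow_succ, ← mul_assoc, hx, sub_mul, sub_mul, hee]
      have hc : x ^ n * (x ^ 3 - x) = (x ^ 3 - x) * x ^ n :=
        (((Commute.refl x).pow_pow n 3).sub_right ((Commute.refl x).pow_left n)).eq
      rw [_root_.pow_succ, ← mul_assoc, ih, mul_assoc, hc, ← mul_assoc, mul_assoc _ e, hx3,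
        _root_.pow_succ, _root_.pow_succ' x]
      simp only [mul_assoc]
  obtain ⟨p, hp⟩ := hn
  exact ⟨p, by rw [key, hp]; simp⟩

theorem scalar_fin_two {R : Type*} [Ring R] (x : R) :
    Matrix.scalar (Fin 2) x = !![x, 0; 0, x] := by
  refine Matrix.ext fun i j ↦ ?_
  fin_cases i <;> fin_cases j <;> simp

/-- If `a` is Hirano invertible, `b` is strongly Drazin invertible with strong
Drazin inverse `bD`, `bD * a = 0` and `a * b * bπ = b * a * bπ` where
`bπ = 1 - b * bD`, then `!![a, 1; b, 0]` is Hirano invertible in `M₂(A)`. -/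
theorem hirano_anti_triangular_comm {A : Type*} [NormedRing A] [NormedAlgebra ℂ A]
    [CompleteSpace A] (a b bD : A) (ha : IsHirano a) (hb : IsSDrazinInv b bD)
    (h1 : bD * a = 0) (h2 : a * b * (1 - b * bD) = b * a * (1 - b * bD)) :
    IsHirano (!![a, 1; b, (0 : A)] : Matrix (Fin 2) (Fin 2) A) := by
  obtain ⟨hc, hy, hn⟩ := hb
  obtain ⟨e, he⟩ : ∃ e, e = b * bD := ⟨_, rfl⟩
  obtain ⟨f, hf⟩ : ∃ f, f = 1 - e := ⟨_, rfl⟩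
  rw [← he] at hn
  have hee : e * e = e := by rw [he, mul_assoc, ← mul_assoc bD, ← hy]
  have hea : e * a = 0 := by rw [he, mul_assoc, h1, mul_zero]
  have hbe : b * e = e * b := by rw [he, mul_assoc, hc]
  have hff : f * f = f := by rw [hf, sub_mul, mul_sub, mul_sub, hee]; simp
  have hfa : f * a = a := by rw [hf, sub_mul, hea]; simp
  have hbf : b * f = f * b := by rw [hf, mul_sub, sub_mul, hbe]; simp
  have hfbf : f * b * f = b * f := by rw [← hbf, mul_assoc, hff]
  have hab : a * b * f = b * a * f := by rw [hf, he, h2]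
  have hfa' (x : A) : f * (a * x) = a * x := by rw [← mul_assoc, hfa]
  have hab' : a * (b * f) = b * (a * f) := by rw [← mul_assoc, hab, mul_assoc]
  have hfbf' : f * (b * f) = b * f := by rw [← mul_assoc, hfbf]
  have hef : e * f = 0 := by rw [hf, mul_sub, hee]; simp
  have hfe : f * e = 0 := by rw [hf, sub_mul, hee]; simp
  have hbn : IsNilpotent (b * f) := by
    have h : (b - e) * f = b * f := by rw [sub_mul, hef, sub_zero]
    rw [← h]
    refine Commute.isNilpotent_mul_right ?_ hn
    rw [Commute, SemiconjBy, h, mul_sub, hfe, sub_zero, hbf]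
  have ha3 := ha.isNilpotent_pow_three_sub_self
  have hfaf : f * a * f = a * f := by rw [hfa]
  have han : IsNilpotent ((a * f) ^ 3 - a * f) := by
    rw [pow_three_sub_self_mul hff hfaf]
    exact isNilpotent_mul_of_mul_mul hff (mul_pow_three_sub_self_mul hff hfaf) ha3
  apply isHirano_of_isNilpotent_pow_three_sub_self
  obtain ⟨M, hM⟩ : ∃ M : Matrix (Fin 2) (Fin 2) A, M = !![a, 1; b, 0] := ⟨_, rfl⟩
  rw [← hM]
  obtain ⟨S, hS⟩ : ∃ S, S = Matrix.scalar (α := A) (Fin 2) := ⟨_, rfl⟩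
  have hS' (x : A) : S x = !![x, 0; 0, x] := hS ▸ scalar_fin_two x
  have hfM : S f * M * S f = M * S f := by
    simp [hM, hS', hfa, hff, hfbf]
  have hFF : S f * S f = S f := by rw [← map_mul, hff]
  obtain ⟨p, hp⟩ : ∃ p, S e * (M ^ 3 - M) ^ p = 0 := by
    refine exists_mul_pow_three_sub_self_pow_eq_zero (b := S b) (by rw [← map_mul, hee])
      ?_ (by rw [← map_sub]; exact hn.map S)
    simp [hM, hS', sq, mul_add, ← mul_assoc, hea, ← hbe]
    simp [mul_assoc, hea]
  obtain ⟨q, hq⟩ : IsNilpotent ((M * S f) ^ 3 - M * S f) := by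
    refine isNilpotent_pow_three_sub_self_of_sq_eq (a := S (a * f)) (b := S (b * f)) ?_ ?_ ?_ ?_
      (by simpa using han.map S) (hbn.map S)
    · simp [hM, hS', mul_assoc, hff, hfa', hab', hfbf']
    · simp [hM, hS', mul_assoc, hff, hfa', hab', hfbf']
    · rw [← map_mul, ← map_mul]
      congr 1
      simp only [mul_assoc, hfa', hfbf', hab']
    · simp [hM, hS', sq, mul_assoc, hff, hfa', hab', hfbf']
  refine isNilpotent_of_mul_pow_eq_zero (e := S e) (f := S f) (p := p) (q := q)
    (by rw [← map_add, hf]; simp) hp ?_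
  rw [← mul_pow_mul_right_of_mul_mul hFF (mul_pow_three_sub_self_mul hFF hfM),
    ← pow_three_sub_self_mul hFF hfM, hq, zero_mul]
end
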